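/- arXiv:2511.05521 — 8 statements merged into one kernel-verified Lean document; each statement's English description precedes it below -/
import Mathlib

section
/- Let n ≥ 3 and let Pₙ ⊂ ℝ² be the regular n-gon with vertices (cos(2πk/n), sin(2πk/n)) for k = 0,…,n−1 (i.e. Pₙ is the convex hull of these points). For m = 1,…,n set a_{m,n} = (1/cos(π/n))·(cos((2m−1)π/n), sin((2m−1)π/n)). Then for every nonzero r ∈ ℝ², the gauge of Pₙ at r equals max_{1 ≤ m ≤ n} ⟨r, a_{m,n}⟩, where ⟨·,·⟩ is the Euclidean inner product. -/
open Real Set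

/-- The vector `(cos t, sin t)` of the unit circle. -/
noncomputable def circlePoint (t : ℝ) : ℝ × ℝ := (Real.cos t, Real.sin t)

lemma circlePoint_add_int_mul_two_pi (t : ℝ) (q : ℤ) :
    circlePoint (t + q * (2 * π)) = circlePoint t := by
  simp only [circlePoint, Real.cos_add_int_mul_two_pi, Real.sin_add_int_mul_two_pi]

lemma exists_eq_smul_circlePoint {r : ℝ × ℝ} (hr : r ≠ 0) :
    ∃ ρ : ℝ, 0 < ρ ∧ ∃ θ : ℝ, r = ρ • circlePoint θ := by
  have hz : (⟨r.1, r.2⟩ : ℂ) ≠ 0 := by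
    intro h
    apply hr
    have h1 := congrArg Complex.re h
    have h2 := congrArg Complex.im h
    exact Prod.ext h1 h2
  refine ⟨‖(⟨r.1, r.2⟩ : ℂ)‖, norm_pos_iff.mpr hz, Complex.arg ⟨r.1, r.2⟩, ?_⟩
  refine Prod.ext ?_ ?_
  · exact (Complex.norm_mul_cos_arg ⟨r.1, r.2⟩).symm
  · exact (Complex.norm_mul_sin_arg ⟨r.1, r.2⟩).symm

lemma cos_le_cos_of_mem_Icc_two_pi_sub {x b : ℝ} (hb : 0 ≤ b) (h1 : b ≤ x)
    (h2 : x ≤ 2 * π - b) : Real.cos x ≤ Real.cos b := by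
  rcases le_total x π with h | h
  · exact Real.cos_le_cos_of_nonneg_of_le_pi hb h h1
  · rw [← Real.cos_two_pi_sub x]
    exact Real.cos_le_cos_of_nonneg_of_le_pi hb (by linarith) (by linarith)

/-- An odd multiple `p * (π / n)` with `|p| < 2 n` has cosine at most `cos (π / n)`. -/
lemma cos_odd_mul_le {n : ℕ} (hn : 0 < n) {p : ℤ} (hp : 1 ≤ |p|) (hp' : |p| ≤ 2 * n - 1) :
    Real.cos (p * (π / n)) ≤ Real.cos (π / n) := by
  have hn' : (0 : ℝ) < n := by exact_mod_cast hn
  have hb : 0 < π / n := by positivity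
  have h1 : (1 : ℝ) ≤ |(p : ℝ)| := by exact_mod_cast hp
  have h2 : |(p : ℝ)| ≤ 2 * n - 1 := by exact_mod_cast hp'
  have hnb : n * (π / n) = π := by field_simp
  rw [← Real.cos_abs, abs_mul, abs_of_pos hb]
  refine cos_le_cos_of_mem_Icc_two_pi_sub hb.le (by nlinarith) ?_
  nlinarith

/-- Decomposition of a point in the cone spanned by two unit vectors at angle `2 b`. -/
lemma circlePoint_eq_smul_add_smul (c b δ : ℝ) (h : Real.sin (2 * b) ≠ 0) :
    circlePoint (c + δ) = (Real.sin (2 * b - δ) / Real.sin (2 * b)) • circlePoint c +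
      (Real.sin δ / Real.sin (2 * b)) • circlePoint (c + 2 * b) := by
  ext
  · simp only [circlePoint, Prod.fst_add, Prod.smul_fst, smul_eq_mul]
    rw [div_mul_eq_mul_div, div_mul_eq_mul_div, ← add_div, eq_div_iff h]
    rw [Real.cos_add, Real.cos_add, Real.sin_sub]
    ring
  · simp only [circlePoint, Prod.snd_add, Prod.smul_snd, smul_eq_mul]
    rw [div_mul_eq_mul_div, div_mul_eq_mul_div, ← add_div, eq_div_iff h]
    rw [Real.sin_add, Real.sin_add, Real.sin_sub]
    ring

lemma sin_sub_add_sin_div (b δ : ℝ) (hs : Real.sin b ≠ 0) (hc : Real.cos b ≠ 0) :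
    Real.sin (2 * b - δ) / Real.sin (2 * b) + Real.sin δ / Real.sin (2 * b) =
      Real.cos (δ - b) / Real.cos b := by
  rw [Real.sin_sub, Real.sin_two_mul, Real.cos_two_mul, Real.cos_sub]
  field_simp
  linear_combination (-2 * Real.sin δ) * Real.sin_sq_add_cos_sq b

lemma circlePoint_mem_convexHull {n : ℕ} (hn : 0 < n) (k : ℤ) :
    circlePoint (k * (2 * (π / n))) ∈ convexHull ℝ (Set.range fun k : Fin n =>
      ((Real.cos (2 * π * k / n), Real.sin (2 * π * k / n)) : ℝ × ℝ)) := by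
  apply subset_convexHull
  have hn' : (n : ℝ) ≠ 0 := by positivity
  have h0 := Int.emod_nonneg k (b := n) (by omega)
  have h1 := Int.emod_lt_of_pos k (b := n) (by omega)
  obtain ⟨j, hj⟩ := Int.eq_ofNat_of_zero_le h0
  refine ⟨⟨j, by omega⟩, ?_⟩
  have hk : (k : ℝ) = j + n * (k / n : ℤ) := by
    have := Int.emod_add_mul_ediv k n
    rw [hj] at this
    exact_mod_cast this.symm
  have : (k : ℝ) * (2 * (π / n)) = 2 * π * j / n + (k / n : ℤ) * (2 * π) := by
    rw [hk]; field_simp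
  rw [this, circlePoint_add_int_mul_two_pi]
  rfl

open scoped Pointwise

/-- The Minkowski functional of the regular `n`-gon `Pₙ` (unit circumradius, centered at the
origin) evaluated at a nonzero vector `r` equals the maximum over the sides of the inner
product `⟨r, a_{m,n}⟩`. -/
theorem stmt_3 (n : ℕ) (hn : 3 ≤ n)
    (P : Set (ℝ × ℝ))
    (hP : P = convexHull ℝ (Set.range fun k : Fin n =>
      ((Real.cos (2 * π * k / n), Real.sin (2 * π * k / n)) : ℝ × ℝ)))
    (a : ℕ → ℝ × ℝ)
    (ha : ∀ m, a m = (1 / Real.cos (π / n)) •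
      ((Real.cos ((2 * (m : ℝ) - 1) * π / n), Real.sin ((2 * (m : ℝ) - 1) * π / n)) : ℝ × ℝ))
    (r : ℝ × ℝ) (hr : r ≠ 0) :
    gauge P r = (Finset.Icc 1 n).sup' (Finset.nonempty_Icc.mpr (by omega))
      (fun m => r.1 * (a m).1 + r.2 * (a m).2) := by
  have hn' : (3 : ℝ) ≤ n := by exact_mod_cast hn
  have hn0 : (n : ℝ) ≠ 0 := by positivity
  obtain ⟨b, hb⟩ : ∃ b, b = π / n := ⟨_, rfl⟩
  have hb0 : 0 < b := by rw [hb]; positivity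
  have hnb : n * b = π := by rw [hb]; field_simp
  have hb3 : 3 * b ≤ π := by nlinarith
  have hcos : 0 < Real.cos b := Real.cos_pos_of_mem_Ioo ⟨by linarith, by linarith⟩
  have hsin : 0 < Real.sin b := Real.sin_pos_of_pos_of_lt_pi hb0 (by linarith)
  have hsin2 : 0 < Real.sin (2 * b) :=
    Real.sin_pos_of_pos_of_lt_pi (by linarith) (by linarith)
  obtain ⟨ρ, hρ, θ, hrθ⟩ := exists_eq_smul_circlePoint hr
  obtain ⟨k, hk⟩ : ∃ k : ℤ, k = ⌊θ / (2 * b)⌋ := ⟨_, rfl⟩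
  obtain ⟨δ, hδ⟩ : ∃ δ, δ = θ - k * (2 * b) := ⟨_, rfl⟩
  have hδ0 : 0 ≤ δ := by
    have := Int.floor_le (θ / (2 * b))
    rw [← hk, le_div_iff₀ (by linarith)] at this
    linarith
  have hδ1 : δ < 2 * b := by
    have := Int.lt_floor_add_one (θ / (2 * b))
    rw [← hk, div_lt_iff₀ (by linarith)] at this
    linarith
  have hθ : θ = k * (2 * b) + δ := by linarith
  obtain ⟨M, hM⟩ : ∃ M, M = ρ * (Real.cos (δ - b) / Real.cos b) := ⟨_, rfl⟩
  have hM0 : 0 < M := by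
    have : 0 < Real.cos (δ - b) := Real.cos_pos_of_mem_Ioo ⟨by linarith, by linarith⟩
    rw [hM]; positivity
  have hrM : r ∈ M • P := by
    have hconv : Convex ℝ P := hP ▸ convex_convexHull ℝ _
    have hv1 : circlePoint (k * (2 * b)) ∈ P := by
      rw [hP, hb]; exact circlePoint_mem_convexHull (by omega) k
    have hv2 : circlePoint (k * (2 * b) + 2 * b) ∈ P := by
      have := circlePoint_mem_convexHull (n := n) (by omega) (k + 1)
      rw [← hb, ← hP] at this
      convert this using 2
      push_cast; ring
    have hsum := sin_sub_add_sin_div b δ hsin.ne' hcos.ne'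
    have hs : 0 ≤ Real.sin (2 * b - δ) :=
      Real.sin_nonneg_of_nonneg_of_le_pi (by linarith) (by linarith)
    have ht : 0 ≤ Real.sin δ := Real.sin_nonneg_of_nonneg_of_le_pi hδ0 (by linarith)
    rw [hrθ, hθ, circlePoint_eq_smul_add_smul _ b δ hsin2.ne']
    refine ⟨(ρ / M * (Real.sin (2 * b - δ) / Real.sin (2 * b))) • circlePoint (k * (2 * b)) +
      (ρ / M * (Real.sin δ / Real.sin (2 * b))) • circlePoint (k * (2 * b) + 2 * b),
      hconv hv1 hv2 (by positivity) (by positivity) ?_, ?_⟩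
    · rw [← mul_add, hsum, div_mul_eq_mul_div, ← hM, div_self hM0.ne']
    · simp only [smul_add, smul_smul]
      congr 2 <;> field_simp
  apply le_antisymm
  · refine (gauge_le_of_mem hM0.le hrM).trans ?_
    have h0 := Int.emod_nonneg k (b := n) (by omega)
    have h1 := Int.emod_lt_of_pos k (b := n) (by omega)
    obtain ⟨j, hj⟩ := Int.eq_ofNat_of_zero_le h0
    have hkj : (k : ℝ) = j + n * (k / n : ℤ) := by
      have := Int.emod_add_mul_ediv k n
      rw [hj] at this
      exact_mod_cast this.symm
    have hmem : j + 1 ∈ Finset.Icc 1 n := by rw [Finset.mem_Icc]; omega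
    refine le_of_eq_of_le ?_
      (Finset.le_sup' (fun m => r.1 * (a m).1 + r.2 * (a m).2) hmem)
    have hang : (2 * ((j + 1 : ℕ) : ℝ) - 1) * π / n = (2 * j + 1) * b := by
      rw [hb]; push_cast; ring
    have hdiff : θ - (2 * j + 1) * b = (δ - b) + (k / n : ℤ) * (2 * π) := by
      rw [hθ, hkj, ← hnb]; ring
    have hc : Real.cos (δ - b) = Real.cos (θ - (2 * j + 1) * b) := by
      rw [hdiff, Real.cos_add_int_mul_two_pi]
    simp only [ha, hang, ← hb, hrθ, circlePoint, Prod.smul_mk, smul_eq_mul]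
    rw [hM, hc, Real.cos_sub]
    ring
  · apply Finset.sup'_le
    intro m hm
    rw [Finset.mem_Icc] at hm
    rw [gauge_def]
    refine le_csInf ⟨M, hM0, hrM⟩ ?_
    rintro ξ ⟨hξ, p, hp, rfl⟩
    have hξ : 0 < ξ := hξ
    have hlin : IsLinearMap ℝ fun x : ℝ × ℝ => x.1 * (a m).1 + x.2 * (a m).2 :=
      ⟨fun x y => by simp only [Prod.fst_add, Prod.snd_add]; ring,
        fun c x => by simp only [Prod.smul_fst, Prod.smul_snd, smul_eq_mul]; ring⟩
    have hhalf : P ⊆ {x : ℝ × ℝ | x.1 * (a m).1 + x.2 * (a m).2 ≤ 1} := by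
      rw [hP]
      refine convexHull_min ?_ (convex_halfSpace_le hlin 1)
      rintro _ ⟨i, rfl⟩
      have hi := i.2
      have hle := cos_odd_mul_le (n := n) (p := 2 * (i : ℕ) - 2 * m + 1) (by omega)
        (by rw [le_abs]; omega) (by rw [abs_le]; omega)
      have hang : ((2 * (i : ℕ) - 2 * m + 1 : ℤ) : ℝ) * (π / n) =
          2 * π * (i : ℕ) / n - (2 * (m : ℝ) - 1) * π / n := by
        push_cast; ring
      rw [hang, Real.cos_sub, ← hb] at hle
      simp only [Set.mem_ofPred_eq, ha, Prod.smul_mk, smul_eq_mul, ← hb]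
      rw [← div_le_one hcos] at hle
      refine le_of_eq_of_le ?_ hle
      ring
    have := hhalf hp
    simp only [Set.mem_ofPred_eq] at this
    simp only [Prod.smul_fst, Prod.smul_snd, smul_eq_mul]
    nlinarith
end

section
/- Let n ≥ 3, let Pₙ ⊂ ℝ² be the regular n-gon with vertices (cos(2πk/n), sin(2πk/n)) for k = 0,…,n−1, and let l = (cos(2π/n) − 1, sin(2π/n)) be a side vector of Pₙ. Then the half-perimeter πₙ = (n/2)·(gauge of Pₙ at l) is given by: πₙ = n·tan(π/n) if n ≡ 0 (mod 4); πₙ = n·tan(π/n)·cos(π/(2n)) if n is odd; πₙ = n·sin(π/n) if n ≡ 2 (mod 4). -/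
open Real Set

/-- Among the odd multiples of `π / n`, the cosine is largest at `π / n` itself. -/
theorem cos_odd_mul_pi_div_le {n : ℕ} (hn : 0 < n) {m : ℤ} (hm : Odd m) :
    Real.cos (m * (π / n)) ≤ Real.cos (π / n) := by
  have hn' : (0 : ℝ) < n := by exact_mod_cast hn
  have ht : 0 < π / n := by positivity
  have hnt : (n : ℝ) * (π / n) = π := by field_simp
  obtain ⟨q, s, hs1, hs2, rfl⟩ : ∃ q s : ℤ, 1 ≤ s ∧ s ≤ 2 * n - 1 ∧ m = s + q * (2 * n) := by
    refine ⟨m / (2 * n), m % (2 * n), ?_, ?_, ?_⟩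
    · have h0 := Int.emod_nonneg m (b := 2 * n) (by omega)
      have h1 : m % (2 * n) ≠ 0 := by
        intro h
        obtain ⟨k, hk⟩ := hm
        obtain ⟨d, hd⟩ := Int.dvd_of_emod_eq_zero h
        rw [mul_assoc] at hd
        omega
      omega
    · have := Int.emod_lt_of_pos m (b := 2 * n) (by omega)
      omega
    · linarith [Int.emod_add_mul_ediv m (2 * n), mul_comm (m / (2 * n)) (2 * (n : ℤ))]
  have hs1' : (1 : ℝ) ≤ s := by exact_mod_cast hs1
  have hs2' : (s : ℝ) ≤ 2 * n - 1 := by exact_mod_cast hs2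
  have hper : ((s + q * (2 * n) : ℤ) : ℝ) * (π / n) = s * (π / n) + q * (2 * π) := by
    push_cast
    linear_combination 2 * (q : ℝ) * hnt
  rw [hper, Real.cos_add_int_mul_two_pi]
  have hlow : π / n ≤ s * (π / n) := by nlinarith
  have hupp : s * (π / n) ≤ 2 * π - π / n := by nlinarith
  rcases le_total (s * (π / n)) π with h | h
  · exact Real.cos_le_cos_of_nonneg_of_le_pi ht.le h hlow
  · rw [← Real.cos_two_pi_sub (s * (π / n))]
    exact Real.cos_le_cos_of_nonneg_of_le_pi ht.le (by linarith) (by linarith)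

/-- The gauge of the regular `n`-gon on the sector spanned by two consecutive vertices. -/
theorem gauge_regular_polygon {n : ℕ} (hn : 3 ≤ n) {j : ℕ} (hj : j + 1 < n) {r δ : ℝ}
    (hr : 0 < r) (hδ : |δ| ≤ π / n) :
    gauge (convexHull ℝ (Set.range fun k : Fin n =>
      ((Real.cos (2 * π * k / n), Real.sin (2 * π * k / n)) : ℝ × ℝ)))
      (r * Real.cos ((2 * j + 1) * (π / n) + δ), r * Real.sin ((2 * j + 1) * (π / n) + δ)) =
      r * (Real.cos δ / Real.cos (π / n)) := by
  have hn' : (3 : ℝ) ≤ n := by exact_mod_cast hn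
  have hangle (x : ℝ) : 2 * π * x / n = 2 * x * (π / n) := by ring
  have htpos : 0 < π / n := by positivity
  have htlt : π / n < π / 2 := div_lt_div_of_pos_left Real.pi_pos (by norm_num) (by linarith)
  simp only [hangle]
  have hodd (m : ℤ) (hm : Odd m) := cos_odd_mul_pi_div_le (n := n) (by omega) hm
  set t : ℝ := π / n
  obtain ⟨hδ1, hδ2⟩ := abs_le.mp hδ
  have hcost : 0 < Real.cos t := Real.cos_pos_of_mem_Ioo ⟨by linarith, htlt⟩
  have hsint : 0 < Real.sin t := Real.sin_pos_of_pos_of_lt_pi htpos (by linarith)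
  have hcosδ : 0 < Real.cos δ := Real.cos_pos_of_mem_Ioo ⟨by linarith, by linarith⟩
  set P := convexHull ℝ (Set.range fun k : Fin n =>
      ((Real.cos (2 * (k : ℕ) * t), Real.sin (2 * (k : ℕ) * t)) : ℝ × ℝ)) with hP
  set μ : ℝ := (2 * j + 1) * t with hμ
  unfold gauge
  apply IsLeast.csInf_eq
  refine ⟨⟨by positivity, ?_⟩, ?_⟩
  · have hv (k : ℕ) (hk : k < n) : (Real.cos (2 * k * t), Real.sin (2 * k * t)) ∈ P :=
      subset_convexHull ℝ _ ⟨⟨k, hk⟩, rfl⟩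
    have h1 : (Real.cos (μ - t), Real.sin (μ - t)) ∈ P := by
      convert hv j (by omega) using 3 <;> rw [hμ] <;> ring
    have h2 : (Real.cos (μ + t), Real.sin (μ + t)) ∈ P := by
      convert hv (j + 1) hj using 3 <;> rw [hμ] <;> push_cast <;> ring
    have ha : 0 ≤ Real.sin (t - δ) :=
      Real.sin_nonneg_of_nonneg_of_le_pi (by linarith) (by linarith)
    have hb : 0 ≤ Real.sin (t + δ) :=
      Real.sin_nonneg_of_nonneg_of_le_pi (by linarith) (by linarith)
    have hd : 0 < 2 * Real.sin t * Real.cos δ := by positivity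
    have hmem := convex_convexHull ℝ _ h1 h2 (div_nonneg ha hd.le) (div_nonneg hb hd.le) (by
      rw [Real.sin_sub, Real.sin_add]; field_simp; ring)
    refine ⟨_, hmem, ?_⟩
    ext
    · simp only [Prod.smul_mk, Prod.mk_add_mk, smul_eq_mul, Real.sin_sub, Real.sin_add,
        Real.cos_sub, Real.cos_add]
      field_simp
      ring
    · simp only [Prod.smul_mk, Prod.mk_add_mk, smul_eq_mul, Real.sin_sub, Real.sin_add,
        Real.cos_sub, Real.cos_add]
      field_simp
      ring
  · rintro ρ ⟨hρ, y, hy, hyv⟩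
    let f : ℝ × ℝ →ₗ[ℝ] ℝ :=
      Real.cos μ • LinearMap.fst ℝ ℝ ℝ + Real.sin μ • LinearMap.snd ℝ ℝ ℝ
    have hsub : P ⊆ {w | f w ≤ Real.cos t} := by
      refine convexHull_min ?_ (convex_halfSpace_le f.isLinear _)
      rintro _ ⟨k, rfl⟩
      have h := hodd (2 * (k : ℕ) - (2 * j + 1)) ⟨(k : ℕ) - j - 1, by ring⟩
      push_cast at h
      rw [sub_mul, Real.cos_sub] at h
      simp only [f, mem_ofPred_eq, LinearMap.add_apply, LinearMap.smul_apply,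
        LinearMap.fst_apply, LinearMap.snd_apply, smul_eq_mul]
      linarith
    have hfy : f y ≤ Real.cos t := hsub hy
    have hfv : ρ * f y = r * Real.cos δ := by
      have h := congrArg f hyv
      simp only [map_smul, smul_eq_mul] at h
      rw [h]
      simp only [f, LinearMap.add_apply, LinearMap.smul_apply,
        LinearMap.fst_apply, LinearMap.snd_apply, smul_eq_mul, Real.cos_add, Real.sin_add]
      linear_combination r * Real.cos δ * Real.sin_sq_add_cos_sq μ
    rw [← mul_div_assoc, div_le_iff₀ hcost, ← hfv]
    exact mul_le_mul_of_nonneg_left hfy hρ.le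

/-- The half-perimeter of the regular `n`-gon when the direction `π / n + π / 2` of its side lies
at signed angle `δ` from the normal of the side joining vertices `j` and `j + 1`. -/
theorem half_perimeter_regular_polygon {n : ℕ} (hn : 3 ≤ n) {j : ℕ} (hj : j + 1 < n) {δ : ℝ}
    (hδ : |δ| ≤ π / n) (hdir : π / n + π / 2 = (2 * j + 1) * (π / n) + δ) :
    ((n : ℝ) / 2) * gauge (convexHull ℝ (Set.range fun k : Fin n =>
      ((Real.cos (2 * π * k / n), Real.sin (2 * π * k / n)) : ℝ × ℝ)))
      (Real.cos (2 * π / n) - 1, Real.sin (2 * π / n)) =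
      n * Real.tan (π / n) * Real.cos δ := by
  have hn' : (3 : ℝ) ≤ n := by exact_mod_cast hn
  have hsin : 0 < Real.sin (π / n) :=
    Real.sin_pos_of_pos_of_lt_pi (by positivity) (div_lt_self Real.pi_pos (by linarith))
  have h := gauge_regular_polygon hn hj (r := 2 * Real.sin (π / n)) (by positivity) hδ
  rw [← hdir, Real.cos_add_pi_div_two, Real.sin_add_pi_div_two] at h
  have hl : ((Real.cos (2 * π / n) - 1, Real.sin (2 * π / n)) : ℝ × ℝ) =
      (2 * Real.sin (π / n) * -Real.sin (π / n), 2 * Real.sin (π / n) * Real.cos (π / n)) := by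
    rw [mul_div_assoc, Real.sin_two_mul, Real.cos_two_mul']
    ext
    · linear_combination Real.sin_sq_add_cos_sq (π / n)
    · rfl
  rw [hl, h, Real.tan_eq_sin_div_cos]
  ring

/-- The half-perimeter `πₙ = (n/2) · gauge Pₙ l` of the regular `n`-gon in its own
Minkowski norm, where `l` is a side vector, is given by the piecewise trigonometric
formula depending on `n mod 4`. -/
theorem stmt_4 (n : ℕ) (hn : 3 ≤ n)
    (P : Set (ℝ × ℝ))
    (hP : P = convexHull ℝ (Set.range fun k : Fin n =>
      ((Real.cos (2 * π * k / n), Real.sin (2 * π * k / n)) : ℝ × ℝ)))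
    (l : ℝ × ℝ) (hl : l = (Real.cos (2 * π / n) - 1, Real.sin (2 * π / n))) :
    (n % 4 = 0 → ((n : ℝ) / 2) * gauge P l = n * Real.tan (π / n)) ∧
    (Odd n → ((n : ℝ) / 2) * gauge P l = n * Real.tan (π / n) * Real.cos (π / (2 * n))) ∧
    (n % 4 = 2 → ((n : ℝ) / 2) * gauge P l = n * Real.sin (π / n)) := by
  subst hP hl
  have hn' : (3 : ℝ) ≤ n := by exact_mod_cast hn
  have htpos : 0 < π / n := by positivity
  have hnt : (n : ℝ) * (π / n) = π := by field_simp
  refine ⟨fun h => ?_, fun h => ?_, fun h => ?_⟩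
  · obtain ⟨p, hp⟩ : ∃ p, n = 4 * p := ⟨n / 4, by omega⟩
    have hpn : (n : ℝ) = 4 * p := by exact_mod_cast hp
    rw [half_perimeter_regular_polygon hn (j := p) (δ := 0) (by omega) (by simpa using htpos.le)
      (by linear_combination (π / n) / 2 * hpn - hnt / 2), Real.cos_zero, mul_one]
  · have hhalf : π / (2 * n) = (π / n) / 2 := by ring
    rw [hhalf]
    obtain ⟨p, hp | hp⟩ : ∃ p, n = 4 * p + 1 ∨ n = 4 * p + 3 := by
      obtain ⟨k, hk⟩ := h
      exact ⟨n / 4, by omega⟩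
    · have hpn : (n : ℝ) = 4 * p + 1 := by exact_mod_cast hp
      exact half_perimeter_regular_polygon hn (j := p) (by omega)
        (by rw [abs_of_pos (by positivity)]; linarith)
        (by linear_combination (π / n) / 2 * hpn - hnt / 2)
    · have hpn : (n : ℝ) = 4 * p + 3 := by exact_mod_cast hp
      rw [← Real.cos_neg (π / n / 2)]
      exact half_perimeter_regular_polygon hn (j := p + 1) (by omega)
        (by rw [abs_neg, abs_of_pos (by positivity)]; linarith)
        (by push_cast; linear_combination (π / n) / 2 * hpn - hnt / 2)
  · obtain ⟨p, hp⟩ : ∃ p, n = 4 * p + 2 := ⟨n / 4, by omega⟩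
    have hpn : (n : ℝ) = 4 * p + 2 := by exact_mod_cast hp
    have hcos : Real.cos (π / n) ≠ 0 := (Real.cos_pos_of_mem_Ioo
      ⟨by linarith [Real.pi_pos], div_lt_div_of_pos_left Real.pi_pos two_pos (by linarith)⟩).ne'
    rw [half_perimeter_regular_polygon hn (j := p) (δ := π / n) (by omega) (abs_of_pos htpos).le
      (by linear_combination (π / n) / 2 * hpn - hnt / 2), mul_assoc, Real.tan_mul_cos hcos]
end

section
/- For every integer n ≥ 3, the quantity (n / (2·cos(π/n))) · ( cos((π/n)·(2·⌊(n+1)/4⌋ − 1)) − cos((π/n)·(2·⌊(n+1)/4⌋ + 1)) ) equals: n·tan(π/n) if n ≡ 0 (mod 4); n·tan(π/n)·cos(π/(2n)) if n is odd; n·sin(π/n) if n ≡ 2 (mod 4). -/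
open Real Set

/-- The difference of cosines factors as a product, for any multiplier `x`. -/
theorem div_two_cos_mul_cos_sub_cos (a θ x : ℝ) :
    a / (2 * Real.cos θ) * (Real.cos (θ * (2 * x - 1)) - Real.cos (θ * (2 * x + 1))) =
      a * Real.tan θ * Real.sin (2 * x * θ) := by
  rw [show θ * (2 * x - 1) = 2 * x * θ - θ by ring,
    show θ * (2 * x + 1) = 2 * x * θ + θ by ring, Real.cos_sub, Real.cos_add,
    Real.tan_eq_sin_div_cos, mul_comm 2 (Real.cos θ), ← div_div]
  ring

theorem floor_natCast_add_one_div_four {n k : ℕ} (h₁ : 4 * k ≤ n + 1) (h₂ : n + 1 < 4 * k + 4) :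
    (⌊((n : ℝ) + 1) / 4⌋ : ℝ) = k := by
  have h : ⌊((n : ℝ) + 1) / 4⌋ = (k : ℤ) := by
    have h₁' : (4 * k : ℝ) ≤ n + 1 := by exact_mod_cast h₁
    have h₂' : (n + 1 : ℝ) < 4 * k + 4 := by exact_mod_cast h₂
    rw [Int.floor_eq_iff]
    push_cast
    constructor <;> linarith
  rw [h, Int.cast_natCast]

/-- The closed-form floor-function expression for the half-perimeter of the regular
`n`-gon equals the piecewise trigonometric form depending on `n mod 4`. -/
theorem stmt_5 (n : ℕ) (hn : 3 ≤ n) :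
    (n % 4 = 0 →
      ((n : ℝ) / (2 * Real.cos (π / n))) *
        (Real.cos ((π / n) * (2 * (⌊((n : ℝ) + 1) / 4⌋ : ℝ) - 1)) -
         Real.cos ((π / n) * (2 * (⌊((n : ℝ) + 1) / 4⌋ : ℝ) + 1))) =
      (n : ℝ) * Real.tan (π / n)) ∧
    (Odd n →
      ((n : ℝ) / (2 * Real.cos (π / n))) *
        (Real.cos ((π / n) * (2 * (⌊((n : ℝ) + 1) / 4⌋ : ℝ) - 1)) -
         Real.cos ((π / n) * (2 * (⌊((n : ℝ) + 1) / 4⌋ : ℝ) + 1))) =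
      (n : ℝ) * Real.tan (π / n) * Real.cos (π / (2 * n))) ∧
    (n % 4 = 2 →
      ((n : ℝ) / (2 * Real.cos (π / n))) *
        (Real.cos ((π / n) * (2 * (⌊((n : ℝ) + 1) / 4⌋ : ℝ) - 1)) -
         Real.cos ((π / n) * (2 * (⌊((n : ℝ) + 1) / 4⌋ : ℝ) + 1))) =
      (n : ℝ) * Real.sin (π / n)) := by
  have hn' : (n : ℝ) ≠ 0 := by positivity
  simp only [div_two_cos_mul_cos_sub_cos]
  refine ⟨fun h ↦ ?_, fun h ↦ ?_, fun h ↦ ?_⟩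
  · obtain ⟨k, hk⟩ : ∃ k, n = 4 * k := ⟨n / 4, by omega⟩
    have hk' : (n : ℝ) = 4 * k := by exact_mod_cast hk
    rw [floor_natCast_add_one_div_four (k := k) (by omega) (by omega),
      show 2 * (k : ℝ) * (π / n) = π / 2 by field_simp; linarith, Real.sin_pi_div_two, mul_one]
  · congr 1
    obtain ⟨k, hk⟩ | ⟨k, hk⟩ : (∃ k, n = 4 * k + 1) ∨ ∃ k, n + 1 = 4 * k := by
      obtain ⟨m, hm⟩ := h
      obtain h | h : n % 4 = 1 ∨ n % 4 = 3 := by omega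
      · exact .inl ⟨n / 4, by omega⟩
      · exact .inr ⟨(n + 1) / 4, by omega⟩
    · have hk' : (n : ℝ) = 4 * k + 1 := by exact_mod_cast hk
      rw [floor_natCast_add_one_div_four (k := k) (by omega) (by omega),
        show 2 * (k : ℝ) * (π / n) = π / 2 - π / (2 * n) by field_simp; linarith,
        Real.sin_pi_div_two_sub]
    · have hk' : (n : ℝ) + 1 = 4 * k := by exact_mod_cast hk
      rw [floor_natCast_add_one_div_four (k := k) (by omega) (by omega),
        show 2 * (k : ℝ) * (π / n) = π / (2 * n) + π / 2 by field_simp; linarith,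
        Real.sin_add_pi_div_two]
  · obtain ⟨k, hk⟩ : ∃ k, n = 4 * k + 2 := ⟨n / 4, by omega⟩
    have hk' : (n : ℝ) = 4 * k + 2 := by exact_mod_cast hk
    have hcos : Real.cos (π / n) ≠ 0 := by
      have h3 : (3 : ℝ) ≤ n := by exact_mod_cast hn
      have hlt : π / n < π / 2 := div_lt_div_of_pos_left Real.pi_pos two_pos (by linarith)
      have hpos : 0 < π / n := by positivity
      exact (Real.cos_pos_of_mem_Ioo ⟨by linarith [Real.pi_pos], hlt⟩).ne'
    rw [floor_natCast_add_one_div_four (k := k) (by omega) (by omega),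
      show 2 * (k : ℝ) * (π / n) = π / 2 - π / n by field_simp; linarith,
      Real.sin_pi_div_two_sub, mul_assoc, Real.tan_mul_cos hcos]
end

section
/- Let πₙ (integer n ≥ 3) be defined by πₙ = n·tan(π/n) if n ≡ 0 (mod 4), πₙ = n·tan(π/n)·cos(π/(2n)) if n is odd, and πₙ = n·sin(π/n) if n ≡ 2 (mod 4). Then: (i) for n ≡ 0 (mod 4), π < πₙ ≤ 4, with πₙ = 4 exactly when n = 4; (ii) for n odd, π < πₙ ≤ 9/2, with πₙ = 9/2 exactly when n = 3; (iii) for n ≡ 2 (mod 4), 3 ≤ πₙ < π, with πₙ = 3 exactly when n = 6. -/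
open Real

theorem lt_natCast_mul_tan_pi_div {n : ℕ} (hn : 3 ≤ n) : π < n * Real.tan (π / n) := by
  have hn' : (3 : ℝ) ≤ n := by exact_mod_cast hn
  have hpos : (0 : ℝ) < n := by linarith
  have hx : 0 < π / n := by positivity
  have hx2 : π / n < π / 2 := by gcongr; linarith
  calc π = n * (π / n) := by field_simp
    _ < n * Real.tan (π / n) := by gcongr; exact Real.lt_tan hx hx2

theorem natCast_mul_tan_pi_div_lt_four {n : ℕ} (hn : 5 ≤ n) : n * Real.tan (π / n) < 4 := by
  have hn' : (5 : ℝ) ≤ n := by exact_mod_cast hn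
  have hpos : (0 : ℝ) < n := by linarith
  have hpi := Real.pi_lt_d2
  have hx : 0 < π / n := by positivity
  have hx5 : π / n < 0.63 := by
    rw [div_lt_iff₀ hpos]; linarith
  have hnx : n * (π / n) = π := by field_simp
  have hcos := Real.one_sub_sq_div_two_le_cos (x := π / n)
  have hc : (0.8 : ℝ) < Real.cos (π / n) := by nlinarith
  rw [Real.tan_eq_sin_div_cos, ← mul_div_assoc, div_lt_iff₀ (by linarith)]
  have hs := mul_lt_mul_of_pos_left (Real.sin_lt hx) hpos
  linarith

theorem lt_tan_two_mul_mul_cos {t : ℝ} (ht : 0 < t) (ht' : t < π / 4) :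
    2 * t < Real.tan (2 * t) * Real.cos t := by
  have ht1 : t < 1 := by linarith [Real.pi_lt_four]
  have hs : t - t ^ 3 / 6 < Real.sin t := Real.sin_gt_sub_cube ht
  have hc : 0 < Real.cos (2 * t) := Real.cos_pos_of_mem_Ioo ⟨by linarith, by linarith⟩
  have hc2 : Real.cos (2 * t) = 1 - 2 * Real.sin t ^ 2 := by
    rw [Real.cos_two_mul, Real.cos_sq']; ring
  have hs34 : 3 / 4 * t ≤ Real.sin t := by nlinarith [mul_pos ht ht]
  have hs3 : (3 / 4 * t) ^ 3 ≤ Real.sin t ^ 3 := by gcongr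
  have hkey : t < Real.sin t * (1 + Real.sin t ^ 2) := by
    nlinarith [pow_pos ht 3]
  rw [Real.tan_eq_sin_div_cos, div_mul_eq_mul_div, lt_div_iff₀ hc, Real.sin_two_mul]
  have h1 := mul_lt_mul_of_pos_right hkey hc
  have h5 : 0 ≤ Real.sin t ^ 5 := pow_nonneg (by linarith) 5
  have h2 : Real.sin t * Real.cos t * Real.cos t = Real.sin t * (1 - Real.sin t ^ 2) := by
    rw [← Real.cos_sq']; ring
  have h3 : Real.sin t * (1 + Real.sin t ^ 2) * Real.cos (2 * t)
      = Real.sin t * (1 - Real.sin t ^ 2) - 2 * Real.sin t ^ 5 := by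
    rw [hc2]; ring
  linarith

theorem lt_natCast_mul_tan_pi_div_mul_cos {n : ℕ} (hn : 3 ≤ n) :
    π < n * Real.tan (π / n) * Real.cos (π / (2 * n)) := by
  have hn' : (3 : ℝ) ≤ n := by exact_mod_cast hn
  have hpos : (0 : ℝ) < n := by linarith
  have h := lt_tan_two_mul_mul_cos (t := π / (2 * n)) (by positivity)
    (by gcongr; linarith)
  have h2 : 2 * (π / (2 * n)) = π / n := by field_simp
  rw [h2] at h
  calc π = n * (π / n) := by field_simp
    _ < n * (Real.tan (π / n) * Real.cos (π / (2 * n))) := by gcongr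
    _ = _ := by ring

theorem natCast_mul_sin_pi_div_lt {n : ℕ} (hn : 0 < n) : n * Real.sin (π / n) < π := by
  have hpos : (0 : ℝ) < n := by exact_mod_cast hn
  calc n * Real.sin (π / n) < n * (π / n) := by gcongr; exact Real.sin_lt (by positivity)
    _ = π := by field_simp

theorem three_lt_natCast_mul_sin_pi_div {n : ℕ} (hn : 10 ≤ n) : 3 < n * Real.sin (π / n) := by
  have hn' : (10 : ℝ) ≤ n := by exact_mod_cast hn
  have hpos : (0 : ℝ) < n := by linarith
  have hpi := Real.pi_lt_d2
  have hpi' := Real.pi_gt_d2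
  have hx : 0 < π / n := by positivity
  have hx1 : π / n < 0.32 := by
    rw [div_lt_iff₀ hpos]; linarith
  have hnx : n * (π / n) = π := by field_simp
  have hs := mul_lt_mul_of_pos_left (Real.sin_gt_sub_cube hx) hpos
  have he : n * (π / n - (π / n) ^ 3 / 6) = π * (1 - (π / n) ^ 2 / 6) := by
    linear_combination (1 - (π / n) ^ 2 / 6) * hnx
  have hq : (π / n) ^ 2 < 0.11 := by nlinarith
  nlinarith

/-- Bounds for the half-perimeters `πₙ` of regular `n`-gons in their own Minkowski norms:
`π < πₙ ≤ 4` for `n ≡ 0 (mod 4)` with equality exactly at `n = 4`;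
`π < πₙ ≤ 9/2` for odd `n` with equality exactly at `n = 3`;
`3 ≤ πₙ < π` for `n ≡ 2 (mod 4)` with the minimum exactly at `n = 6`. -/
theorem stmt_11 (piN : ℕ → ℝ)
    (h0 : ∀ n : ℕ, 3 ≤ n → n % 4 = 0 → piN n = n * Real.tan (π / n))
    (hodd : ∀ n : ℕ, 3 ≤ n → Odd n → piN n = n * Real.tan (π / n) * Real.cos (π / (2 * n)))
    (h2 : ∀ n : ℕ, 3 ≤ n → n % 4 = 2 → piN n = n * Real.sin (π / n)) :
    ∀ n : ℕ, 3 ≤ n →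
      (n % 4 = 0 → π < piN n ∧ piN n ≤ 4 ∧ (piN n = 4 ↔ n = 4)) ∧
      (Odd n → π < piN n ∧ piN n ≤ 9 / 2 ∧ (piN n = 9 / 2 ↔ n = 3)) ∧
      (n % 4 = 2 → 3 ≤ piN n ∧ piN n < π ∧ (piN n = 3 ↔ n = 6)) := by
  intro n hn
  refine ⟨fun h => ?_, fun h => ?_, fun h => ?_⟩
  · rw [h0 n hn h]
    refine ⟨lt_natCast_mul_tan_pi_div hn, ?_⟩
    rcases eq_or_ne n 4 with rfl | hne
    · norm_num [Real.tan_pi_div_four]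
    · have hlt := natCast_mul_tan_pi_div_lt_four (n := n) (by omega)
      exact ⟨hlt.le, iff_of_false hlt.ne hne⟩
  · rw [hodd n hn h]
    refine ⟨lt_natCast_mul_tan_pi_div_mul_cos hn, ?_⟩
    rcases eq_or_ne n 3 with rfl | hne
    · have hval : ((3 : ℕ) : ℝ) * Real.tan (π / (3 : ℕ)) * Real.cos (π / (2 * (3 : ℕ)))
          = 9 / 2 := by
        norm_num [Real.tan_pi_div_three, Real.cos_pi_div_six]
        linear_combination (3 / 2) * Real.sq_sqrt (show (0 : ℝ) ≤ 3 by norm_num)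
      exact ⟨hval.le, iff_of_true hval rfl⟩
    · obtain ⟨k, hk⟩ := h
      have hlt := natCast_mul_tan_pi_div_lt_four (n := n) (by omega)
      have hpos := Real.pi_pos.trans (lt_natCast_mul_tan_pi_div hn)
      have hle := mul_le_of_le_one_right hpos.le (Real.cos_le_one (π / (2 * n)))
      have hlt' : n * Real.tan (π / n) * Real.cos (π / (2 * n)) < 9 / 2 := by linarith
      exact ⟨hlt'.le, iff_of_false hlt'.ne hne⟩
  · rw [h2 n hn h]
    have hlt := natCast_mul_sin_pi_div_lt (n := n) (by omega)
    rcases eq_or_ne n 6 with rfl | hne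
    · have hval : ((6 : ℕ) : ℝ) * Real.sin (π / (6 : ℕ)) = 3 := by
        norm_num [Real.sin_pi_div_six]
      exact ⟨hval.ge, hlt, iff_of_true hval rfl⟩
    · have hgt := three_lt_natCast_mul_sin_pi_div (n := n) (by omega)
      exact ⟨hgt.le, hlt, iff_of_false hgt.ne' hne⟩
end

section
/- Let πₙ (integer n ≥ 3) be defined by πₙ = n·tan(π/n) if n ≡ 0 (mod 4), πₙ = n·tan(π/n)·cos(π/(2n)) if n is odd, and πₙ = n·sin(π/n) if n ≡ 2 (mod 4). Then for every integer n ≥ 3, 3 ≤ πₙ ≤ 9/2. -/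
open Real

/-- An upper bound for the half-perimeter of the regular `n`-gon circumscribed about the unit
circle. -/
theorem natCast_mul_tan_pi_div_le {n : ℕ} (hn : 5 ≤ n) : n * Real.tan (π / n) ≤ 9 / 2 := by
  have hn5 : (5 : ℝ) ≤ n := by exact_mod_cast hn
  have hn0 : (0 : ℝ) < n := by linarith
  have hx0 : 0 < π / n := by positivity
  have hx : π / n ≤ 63 / 100 := by
    rw [div_le_iff₀ hn0]
    linarith [pi_lt_d2]
  have hnx : n * (π / n) = π := by field_simp
  have hcos := one_sub_sq_div_two_le_cos (x := π / n)
  have hc : 4 / 5 ≤ cos (π / n) := by nlinarith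
  rw [tan_eq_sin_div_cos, ← mul_div_assoc, div_le_iff₀ (by linarith)]
  have hs := mul_le_mul_of_nonneg_left (sin_le hx0.le) hn0.le
  linarith [pi_lt_d2]

/-- A lower bound for the half-perimeter of a regular polygon inscribed in the unit circle. -/
theorem three_le_mul_sin_pi_div {m : ℝ} (hm : 10 ≤ m) : 3 ≤ m * Real.sin (π / m) := by
  have hm0 : 0 < m := by linarith
  have hx0 : 0 < π / m := by positivity
  have hx : π / m ≤ 315 / 1000 := by
    rw [div_le_iff₀ hm0]
    linarith [pi_lt_d2]
  have hmx : m * (π / m) = π := by field_simp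
  have hs := mul_le_mul_of_nonneg_left (sin_gt_sub_cube hx0).le hm0.le
  have hcube : m * (π / m - (π / m) ^ 3 / 6) = π * (1 - (π / m) ^ 2 / 6) := by
    linear_combination (1 - (π / m) ^ 2 / 6) * hmx
  have hq : 97 / 100 ≤ 1 - (π / m) ^ 2 / 6 := by nlinarith
  nlinarith [pi_gt_d2]

theorem two_mul_sin_le_tan_two_mul_mul_cos {y : ℝ} (hy : 0 ≤ y) (hy' : y < π / 4) :
    2 * Real.sin y ≤ Real.tan (2 * y) * Real.cos y := by
  have hc : 0 < cos (2 * y) := cos_pos_of_mem_Ioo ⟨by linarith, by linarith⟩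
  have hs : 0 ≤ sin y := sin_nonneg_of_nonneg_of_le_pi hy (by linarith)
  rw [tan_eq_sin_div_cos, div_mul_eq_mul_div, le_div_iff₀ hc, sin_two_mul, cos_two_mul]
  nlinarith [mul_nonneg hs (sub_nonneg.2 (cos_sq_le_one y))]

/-- Combining the three families of regular polygons, the half-perimeter `πₙ` of the
regular `n`-gon in its own Minkowski norm satisfies `3 ≤ πₙ ≤ 9/2` for every `n ≥ 3`. -/
theorem stmt_12 (piN : ℕ → ℝ)
    (h0 : ∀ n : ℕ, 3 ≤ n → n % 4 = 0 → piN n = n * Real.tan (π / n))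
    (hodd : ∀ n : ℕ, 3 ≤ n → Odd n → piN n = n * Real.tan (π / n) * Real.cos (π / (2 * n)))
    (h2 : ∀ n : ℕ, 3 ≤ n → n % 4 = 2 → piN n = n * Real.sin (π / n)) :
    ∀ n : ℕ, 3 ≤ n → 3 ≤ piN n ∧ piN n ≤ 9 / 2 := by
  intro n hn
  have hn0 : (0 : ℝ) < n := by exact_mod_cast (by omega : 0 < n)
  have hcast {k : ℕ} (hk : k ≤ n) : (k : ℝ) ≤ n := by exact_mod_cast hk
  rcases Nat.even_or_odd n with he | ho
  · have hmod : n % 4 = 0 ∨ n % 4 = 2 := by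
      have := Nat.even_iff.1 he
      omega
    rcases hmod with hmod | hmod
    · rw [h0 n hn hmod]
      constructor
      · have hn4 : (4 : ℝ) ≤ n := hcast (k := 4) (by omega)
        have hlt : π / n < π / 2 := div_lt_div_of_pos_left pi_pos two_pos (by linarith)
        have ht := mul_le_mul_of_nonneg_left (le_tan (by positivity) hlt) hn0.le
        have hnx : n * (π / n) = π := by field_simp
        linarith [pi_gt_three]
      · obtain rfl | h5 : n = 4 ∨ 5 ≤ n := by omega
        · norm_num [tan_pi_div_four]
        · exact natCast_mul_tan_pi_div_le h5
    · rw [h2 n hn hmod]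
      obtain rfl | h10 : n = 6 ∨ 10 ≤ n := by omega
      · norm_num [sin_pi_div_six]
      · refine ⟨three_le_mul_sin_pi_div (hcast h10), ?_⟩
        have hs := mul_le_mul_of_nonneg_left (sin_le (by positivity : 0 ≤ π / n)) hn0.le
        have hnx : n * (π / n) = π := by field_simp
        linarith [pi_lt_d2]
  · rw [hodd n hn ho]
    obtain rfl | h5 : n = 3 ∨ 5 ≤ n := by
      have := Nat.odd_iff.1 ho
      omega
    · have h6 : π / (2 * 3) = π / 6 := by norm_num
      have hsq : √3 * √3 = (3 : ℝ) := mul_self_sqrt (by norm_num)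
      push_cast
      rw [h6, tan_pi_div_three, cos_pi_div_six]
      constructor <;> linarith
    · have hn5 : (5 : ℝ) ≤ n := hcast h5
      have hy : π / (2 * n) < π / 4 := div_lt_div_of_pos_left pi_pos (by norm_num) (by linarith)
      have hy0 : 0 < π / (2 * n) := by positivity
      have h2y : 2 * (π / (2 * n)) = π / n := by field_simp
      constructor
      · have h := two_mul_sin_le_tan_two_mul_mul_cos hy0.le hy
        rw [h2y] at h
        have h3 := three_le_mul_sin_pi_div (m := 2 * n) (by linarith)
        nlinarith [mul_le_mul_of_nonneg_left h hn0.le]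
      · have ht : 0 ≤ tan (π / n) :=
          tan_nonneg_of_nonneg_of_le_pi_div_two (by positivity) (by linarith)
        exact (mul_le_of_le_one_right (by positivity) (cos_le_one _)).trans
          (natCast_mul_tan_pi_div_le h5)
end

section
/- Let m ≥ 1 and n = 4m + 2, and let P ⊂ ℝ² be the regular n-gon with vertices (cos(2πk/n), sin(2πk/n)), k = 0,…,n−1, so that P is centrally symmetric and its gauge is a norm. Then Birkhoff orthogonality with respect to this norm is symmetric: for all nonzero x, y ∈ ℝ², if gauge P (x + t•y) ≥ gauge P x for all real t, then gauge P (y + t•x) ≥ gauge P y for all real t. (That is, the norm with unit ball P is a Radon norm.) -/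
open Real

/-- The `k`-th vertex of the regular `n`-gon inscribed in the unit circle. -/
noncomputable def polygonVertex (n : ℕ) (k : ℤ) : ℝ × ℝ :=
  (cos (2 * π * k / n), sin (2 * π * k / n))

/-- The regular `n`-gon inscribed in the unit circle. -/
noncomputable def regularPolygon (n : ℕ) : Set (ℝ × ℝ) :=
  convexHull ℝ (Set.range fun k : Fin n =>
    ((cos (2 * π * k / n), sin (2 * π * k / n)) : ℝ × ℝ))

/-- The standard area form on the plane. -/
def areaForm (p q : ℝ × ℝ) : ℝ := p.1 * q.2 - p.2 * q.1

lemma convex_regularPolygon (n : ℕ) : Convex ℝ (regularPolygon n) := convex_convexHull _ _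

lemma polygonVertex_mem {n : ℕ} (hn : n ≠ 0) (k : ℤ) :
    polygonVertex n k ∈ regularPolygon n := by
  apply subset_convexHull
  have hn' : (n : ℤ) ≠ 0 := by exact_mod_cast hn
  have hnR : (n : ℝ) ≠ 0 := by exact_mod_cast hn
  have h0 := Int.emod_nonneg k hn'
  have h1 : k % n < n := Int.emod_lt_of_pos k (by omega)
  refine ⟨⟨(k % n).toNat, by omega⟩, ?_⟩
  have hcast : (((k % n).toNat : ℕ) : ℝ) = k - n * ((k / n : ℤ) : ℝ) := by
    have : (((k % n).toNat : ℕ) : ℤ) = k - n * (k / n) := by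
      rw [Int.toNat_of_nonneg h0, Int.emod_def]
    exact_mod_cast this
  have hang : 2 * π * (k - n * ((k / n : ℤ) : ℝ)) / n
      = 2 * π * k / n - ((k / n : ℤ) : ℝ) * (2 * π) := by
    field_simp
  simp only [hcast, hang, polygonVertex, cos_sub_int_mul_two_pi, sin_sub_int_mul_two_pi]

lemma areaForm_polygonVertex (n : ℕ) (k l : ℤ) :
    areaForm (polygonVertex n k) (polygonVertex n l) = sin (2 * π * (l - k : ℤ) / n) := by
  have : 2 * π * ((l - k : ℤ) : ℝ) / n = 2 * π * l / n - 2 * π * k / n := by push_cast; ring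
  rw [this, sin_sub, areaForm, polygonVertex, polygonVertex]
  ring

/-- Among the odd multiples of `π / N` with `N` a positive integer, `π / N` has maximal cosine. -/
lemma cos_odd_mul_pi_div_le_s13 {N : ℤ} (hN : 0 < N) {r : ℤ} (hr : Odd r) :
    cos (r * π / N) ≤ cos (π / N) := by
  have hNR : (0 : ℝ) < N := by exact_mod_cast hN
  set q := r / (2 * N)
  set s := r % (2 * N)
  have hrs : r = s + 2 * N * q := (Int.emod_add_mul_ediv r (2 * N)).symm
  have hs0 : 0 ≤ s := Int.emod_nonneg _ (by omega)
  have hs2 : s < 2 * N := Int.emod_lt_of_pos _ (by omega)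
  have hs1 : 1 ≤ s := by
    rcases hs0.lt_or_eq with h | h
    · omega
    · exfalso
      rw [← h, mul_assoc] at hrs
      obtain ⟨d, hd⟩ := hr
      omega
  have h1 : (1 : ℝ) ≤ s := by exact_mod_cast hs1
  have h2 : (s : ℝ) ≤ 2 * N - 1 := by exact_mod_cast (show s ≤ 2 * N - 1 by omega)
  have hN1 : (1 : ℝ) ≤ N := by exact_mod_cast hN
  have hang : (r : ℝ) * π / N = s * π / N + q * (2 * π) := by
    rw [hrs]; push_cast; field_simp
  rw [hang, cos_add_int_mul_two_pi]
  rcases le_total (s : ℝ) N with h | h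
  · apply cos_le_cos_of_nonneg_of_le_pi (by positivity)
    · rw [div_le_iff₀ hNR]; nlinarith [pi_pos]
    · gcongr; nlinarith [pi_pos]
  · rw [← cos_two_pi_sub]
    have : 2 * π - s * π / N = (2 * N - s) * π / N := by field_simp
    rw [this]
    apply cos_le_cos_of_nonneg_of_le_pi (by positivity)
    · rw [div_le_iff₀ hNR]; nlinarith [pi_pos]
    · gcongr; nlinarith [pi_pos]

lemma sin_two_pi_mul_div_le (m : ℕ) (j : ℤ) :
    sin (2 * π * j / (4 * m + 2 : ℕ)) ≤ cos (π / (4 * m + 2 : ℕ)) := by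
  have hc : 0 ≤ cos (π / (4 * m + 2 : ℕ)) := by
    apply cos_nonneg_of_neg_pi_div_two_le_of_le
    · have := pi_pos
      have : 0 ≤ π / (4 * m + 2 : ℕ) := by positivity
      linarith
    · apply div_le_div_of_nonneg_left pi_pos.le (by norm_num)
      push_cast
      linarith [(Nat.cast_nonneg m : (0 : ℝ) ≤ m)]
  apply le_of_sq_le_sq _ hc
  have hm : (0 : ℝ) < 2 * m + 1 := by positivity
  have h := cos_odd_mul_pi_div_le_s13 (N := 2 * m + 1) (by positivity) (r := 2 * m + 1 - 2 * j)
    ⟨m - j, by ring⟩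
  have e1 : 2 * (2 * π * j / (4 * m + 2 : ℕ))
      = π - ((2 * m + 1 - 2 * j : ℤ) : ℝ) * π / ((2 * m + 1 : ℤ) : ℝ) := by
    push_cast
    have : (4 * m + 2 : ℝ) = 2 * (2 * m + 1) := by ring
    rw [this]; field_simp; ring
  have e2 : π / ((2 * m + 1 : ℤ) : ℝ) = 2 * (π / (4 * m + 2 : ℕ)) := by
    push_cast
    have : (4 * m + 2 : ℝ) = 2 * (2 * m + 1) := by ring
    rw [this]; field_simp
  have h3 := cos_sq (π / (4 * m + 2 : ℕ))
  have h4 := cos_sq (2 * π * j / (4 * m + 2 : ℕ))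
  have h5 := sin_sq_add_cos_sq (2 * π * j / (4 * m + 2 : ℕ))
  rw [e1, cos_pi_sub] at h4
  rw [e2] at h
  linarith

lemma areaForm_le_of_mem (m : ℕ) {p q : ℝ × ℝ} (hp : p ∈ regularPolygon (4 * m + 2))
    (hq : q ∈ regularPolygon (4 * m + 2)) :
    areaForm p q ≤ cos (π / (4 * m + 2 : ℕ)) := by
  have hleft (q : ℝ × ℝ) : IsLinearMap ℝ (fun p => areaForm p q) :=
    ⟨fun a b => by simp [areaForm]; ring, fun a b => by simp [areaForm]; ring⟩
  have hright (p : ℝ × ℝ) : IsLinearMap ℝ (fun q => areaForm p q) :=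
    ⟨fun a b => by simp [areaForm]; ring, fun a b => by simp [areaForm]; ring⟩
  refine convexHull_min ?_ (convex_halfSpace_le (hleft q) _) hp
  rintro _ ⟨k, rfl⟩
  refine convexHull_min ?_ (convex_halfSpace_le (hright _) _) hq
  rintro _ ⟨l, rfl⟩
  have h := areaForm_polygonVertex (4 * m + 2) (k : ℕ) (l : ℕ)
  simp only [polygonVertex, Int.cast_natCast] at h
  simp only [Set.mem_ofPred_eq, h]
  exact sin_two_pi_mul_div_le m _

lemma abs_areaForm_le_of_mem (m : ℕ) {p q : ℝ × ℝ} (hp : p ∈ regularPolygon (4 * m + 2))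
    (hq : q ∈ regularPolygon (4 * m + 2)) :
    |areaForm p q| ≤ cos (π / (4 * m + 2 : ℕ)) := by
  rw [abs_le']
  refine ⟨areaForm_le_of_mem m hp hq, le_of_eq_of_le ?_ (areaForm_le_of_mem m hq hp)⟩
  simp only [areaForm]; ring

/-- Every vector lies in the cone spanned by two adjacent vertices of the polygon. -/
lemma exists_eq_add_polygonVertex {n : ℕ} (hn : 2 < n) (y : ℝ × ℝ) :
    ∃ (k : ℤ) (a b : ℝ), 0 ≤ a ∧ 0 ≤ b ∧
      y = a • polygonVertex n k + b • polygonVertex n (k + 1) := by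
  set z : ℂ := ⟨y.1, y.2⟩
  have hnR : (2 : ℝ) < n := by exact_mod_cast hn
  have hn0 : (0 : ℝ) < n := by linarith
  have hpi := pi_pos
  set φ := z.arg
  have hy1 : y.1 = ‖z‖ * cos φ := (Complex.norm_mul_cos_arg z).symm
  have hy2 : y.2 = ‖z‖ * sin φ := (Complex.norm_mul_sin_arg z).symm
  set k := ⌊φ * n / (2 * π)⌋
  have hk1 : (k : ℝ) ≤ φ * n / (2 * π) := Int.floor_le _
  have hk2 : φ * n / (2 * π) < k + 1 := Int.lt_floor_add_one _
  rw [le_div_iff₀ (by positivity)] at hk1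
  rw [div_lt_iff₀ (by positivity)] at hk2
  set α := 2 * π * k / n with hα
  set δ := 2 * π / n with hδ
  have hδ0 : 0 < δ := by positivity
  have hδπ : δ < π := by rw [hδ, div_lt_iff₀ hn0]; nlinarith
  have h1 : α ≤ φ := by rw [hα, div_le_iff₀ hn0]; linarith
  have h2 : φ ≤ α + δ := by
    rw [hα, hδ, ← add_div, le_div_iff₀ hn0]; linarith
  have hs : 0 < sin δ := sin_pos_of_pos_of_lt_pi hδ0 hδπ
  have hα' : 2 * π * ((k + 1 : ℤ) : ℝ) / n = α + δ := by push_cast; ring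
  refine ⟨k, ‖z‖ * sin (α + δ - φ) / sin δ, ‖z‖ * sin (φ - α) / sin δ, ?_, ?_, ?_⟩
  · have := sin_nonneg_of_nonneg_of_le_pi (x := α + δ - φ) (by linarith) (by linarith)
    positivity
  · have := sin_nonneg_of_nonneg_of_le_pi (x := φ - α) (by linarith) (by linarith)
    positivity
  · have hsc := sin_sq_add_cos_sq α
    ext
    · simp only [polygonVertex, hα', ← hα, Prod.fst_add, Prod.smul_fst, smul_eq_mul]
      rw [hy1]
      field_simp
      simp only [sin_sub, sin_add, cos_add]
      linear_combination (-‖z‖ * cos φ * sin δ) * hsc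
    · simp only [polygonVertex, hα', ← hα, Prod.snd_add, Prod.smul_snd, smul_eq_mul]
      rw [hy2]
      field_simp
      simp only [sin_sub, sin_add, cos_add]
      linear_combination (-‖z‖ * sin φ * sin δ) * hsc

lemma neg_polygonVertex (m : ℕ) (k : ℤ) :
    -polygonVertex (4 * m + 2) k = polygonVertex (4 * m + 2) (k + (2 * m + 1)) := by
  have e : 2 * π * ((k + (2 * m + 1) : ℤ) : ℝ) / (4 * m + 2 : ℕ)
      = 2 * π * k / (4 * m + 2 : ℕ) + π := by
    have : (4 * m + 2 : ℝ) ≠ 0 := by positivity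
    push_cast; field_simp; ring
  simp only [polygonVertex, e, cos_add_pi, sin_add_pi, Prod.neg_mk]

lemma zero_mem_regularPolygon (m : ℕ) : (0 : ℝ × ℝ) ∈ regularPolygon (4 * m + 2) := by
  have hv (j : ℤ) := polygonVertex_mem (n := 4 * m + 2) (by omega) j
  have h := (convex_regularPolygon (4 * m + 2)) (hv 0) (hv (0 + (2 * m + 1)))
    (a := 1 / 2) (b := 1 / 2) (by norm_num) (by norm_num) (by norm_num)
  rwa [← neg_polygonVertex, smul_neg, add_neg_cancel] at h

open scoped Pointwise in
lemma exists_mem_smul_regularPolygon {m : ℕ} (hm : 1 ≤ m) (y : ℝ × ℝ) :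
    ∃ r : ℝ, 0 < r ∧ y ∈ r • regularPolygon (4 * m + 2) := by
  obtain ⟨k, a, b, ha, hb, rfl⟩ := exists_eq_add_polygonVertex (n := 4 * m + 2) (by omega) y
  have hv (j : ℤ) := polygonVertex_mem (n := 4 * m + 2) (by omega) j
  refine ⟨a + b + 1, by positivity, ?_⟩
  rw [(convex_regularPolygon _).add_smul (by positivity) zero_le_one,
    (convex_regularPolygon _).add_smul ha hb, one_smul]
  exact ⟨_, Set.add_mem_add (Set.smul_mem_smul_set (hv _)) (Set.smul_mem_smul_set (hv _)),
    0, zero_mem_regularPolygon m, add_zero _⟩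

open scoped Pointwise in
lemma exists_mem_smul_of_gauge_lt {m : ℕ} (hm : 1 ≤ m) {y : ℝ × ℝ} {s : ℝ}
    (hs : gauge (regularPolygon (4 * m + 2)) y < s) :
    ∃ r : ℝ, 0 < r ∧ r < s ∧ y ∈ r • regularPolygon (4 * m + 2) := by
  obtain ⟨r, ⟨hr, hyr⟩, hrs⟩ := exists_lt_of_csInf_lt (exists_mem_smul_regularPolygon hm y) hs
  exact ⟨r, hr, hrs, hyr⟩

lemma le_mul_of_forall_gt {A B g : ℝ} (h : ∀ s, g < s → A ≤ B * s) : A ≤ B * g := by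
  have ht : Filter.Tendsto (fun s => B * s) (nhdsWithin g (Set.Ioi g)) (nhds (B * g)) :=
    ((continuous_const.mul continuous_id).tendsto g).mono_left nhdsWithin_le_nhds
  exact ge_of_tendsto ht (Filter.eventually_of_mem self_mem_nhdsWithin h)

open scoped Pointwise in
lemma abs_areaForm_le (m : ℕ) (hm : 1 ≤ m) (x y : ℝ × ℝ) :
    |areaForm x y| ≤ cos (π / (4 * m + 2 : ℕ)) * gauge (regularPolygon (4 * m + 2)) x
      * gauge (regularPolygon (4 * m + 2)) y := by
  refine le_mul_of_forall_gt fun s hs => ?_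
  obtain ⟨σ, hσ, hσs, q, hq, rfl⟩ := exists_mem_smul_of_gauge_lt hm hs
  rw [mul_right_comm]
  refine le_mul_of_forall_gt fun r hr => ?_
  obtain ⟨ρ, hρ, hρr, p, hp, rfl⟩ := exists_mem_smul_of_gauge_lt hm hr
  have h := abs_areaForm_le_of_mem m hp hq
  have hc := (abs_nonneg _).trans h
  have hs0 := hσ.trans hσs
  have e : areaForm (ρ • p) (σ • q) = areaForm p q * σ * ρ := by
    simp [areaForm]; ring
  simp only [e, abs_mul, abs_of_pos hρ, abs_of_pos hσ]
  gcongr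

open scoped Pointwise in
lemma exists_gauge_le_areaForm (m : ℕ) (hm : 1 ≤ m) (y : ℝ × ℝ) :
    ∃ k : ℤ, cos (π / (4 * m + 2 : ℕ)) * gauge (regularPolygon (4 * m + 2)) y
      ≤ areaForm (polygonVertex (4 * m + 2) k) y := by
  obtain ⟨k, a, b, ha, hb, rfl⟩ := exists_eq_add_polygonVertex (n := 4 * m + 2) (by omega) y
  have hv (j : ℤ) := polygonVertex_mem (n := 4 * m + 2) (by omega) j
  have hm0 : (0 : ℝ) < 4 * m + 2 := by positivity
  have hc : 0 ≤ cos (π / (4 * m + 2 : ℕ)) :=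
    (abs_nonneg _).trans (abs_areaForm_le_of_mem m (hv 0) (hv 0))
  have hg : gauge (regularPolygon (4 * m + 2)) (a • polygonVertex (4 * m + 2) k
      + b • polygonVertex (4 * m + 2) (k + 1)) ≤ a + b := by
    apply gauge_le_of_mem (by positivity)
    rw [(convex_regularPolygon _).add_smul ha hb]
    exact Set.add_mem_add (Set.smul_mem_smul_set (hv _)) (Set.smul_mem_smul_set (hv _))
  refine ⟨k - m, (mul_le_mul_of_nonneg_left hg hc).trans_eq ?_⟩
  have h1 := areaForm_polygonVertex (4 * m + 2) (k - m) k
  have h2 := areaForm_polygonVertex (4 * m + 2) (k - m) (k + 1)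
  have e1 : 2 * π * ((k - (k - m) : ℤ) : ℝ) / (4 * m + 2 : ℕ)
      = π / 2 - π / (4 * m + 2 : ℕ) := by
    push_cast; field_simp; ring
  have e2 : 2 * π * ((k + 1 - (k - m) : ℤ) : ℝ) / (4 * m + 2 : ℕ)
      = π / (4 * m + 2 : ℕ) + π / 2 := by
    push_cast; field_simp; ring
  rw [e1, sin_pi_div_two_sub] at h1
  rw [e2, sin_add_pi_div_two] at h2
  simp only [areaForm, Prod.fst_add, Prod.snd_add, Prod.smul_fst, Prod.smul_snd,
    smul_eq_mul] at h1 h2 ⊢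
  linear_combination (-a) * h1 - b * h2

open scoped Pointwise in
lemma gauge_smul_polygonVertex_le (m : ℕ) (a : ℝ) (k : ℤ) :
    gauge (regularPolygon (4 * m + 2)) (a • polygonVertex (4 * m + 2) k) ≤ |a| := by
  have hv (j : ℤ) := polygonVertex_mem (n := 4 * m + 2) (by omega) j
  apply gauge_le_of_mem (abs_nonneg a)
  rcases abs_choice a with h | h
  · rw [h]; exact Set.smul_mem_smul_set (hv k)
  · rw [h]
    exact ⟨_, hv (k + (2 * m + 1)), by
      simp only [← neg_polygonVertex, smul_neg, neg_smul, neg_neg]⟩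

lemma gauge_regularPolygon_pos (m : ℕ) (hm : 1 ≤ m) {x : ℝ × ℝ} (hx : x ≠ 0) :
    0 < gauge (regularPolygon (4 * m + 2)) x := by
  refine (gauge_nonneg x).lt_of_ne fun h => hx ?_
  have h1 := abs_areaForm_le m hm x (1, 0)
  have h2 := abs_areaForm_le m hm x (0, 1)
  simp only [← h, mul_zero, zero_mul, abs_nonpos_iff, areaForm] at h1 h2
  ext
  · simpa using h2
  · simpa using h1

/-- The norm whose unit ball is the regular `(4m+2)`-gon is a Radon norm:
Birkhoff orthogonality with respect to it is a symmetric relation. -/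
theorem stmt_13 (m : ℕ) (hm : 1 ≤ m) (n : ℕ) (hn : n = 4 * m + 2)
    (P : Set (ℝ × ℝ))
    (hP : P = convexHull ℝ (Set.range fun k : Fin n =>
      ((Real.cos (2 * π * k / n), Real.sin (2 * π * k / n)) : ℝ × ℝ)))
    (x y : ℝ × ℝ) (hx : x ≠ 0) (hy : y ≠ 0)
    (hxy : ∀ t : ℝ, gauge P x ≤ gauge P (x + t • y)) :
    ∀ t : ℝ, gauge P y ≤ gauge P (y + t • x) := by
  intro t
  change P = regularPolygon n at hP
  subst hn
  subst hP
  have hgx := gauge_regularPolygon_pos m hm hx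
  have hgy := gauge_regularPolygon_pos m hm hy
  have hc : 0 < cos (π / (4 * m + 2 : ℕ)) := by
    have h := abs_areaForm_le m hm (1, 0) (0, 1)
    have h1 := gauge_nonneg (s := regularPolygon (4 * m + 2)) ((1, 0) : ℝ × ℝ)
    have h2 := gauge_nonneg (s := regularPolygon (4 * m + 2)) ((0, 1) : ℝ × ℝ)
    by_contra! hneg
    have := mul_nonpos_of_nonpos_of_nonneg (mul_nonpos_of_nonpos_of_nonneg hneg h1) h2
    have h3 : areaForm (1, 0) (0, 1) = 1 := by simp [areaForm]
    rw [h3, abs_one] at h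
    linarith
  obtain ⟨k, hk⟩ := exists_gauge_le_areaForm m hm y
  set w := polygonVertex (4 * m + 2) k
  have hw : 0 < areaForm w y := lt_of_lt_of_le (by positivity) hk
  have hdec : x + (areaForm w x * (-1) / areaForm w y) • y
      = (areaForm x y / areaForm w y) • w := by
    ext
    · simp only [Prod.fst_add, Prod.smul_fst, smul_eq_mul]
      field_simp
      simp only [areaForm]; ring
    · simp only [Prod.snd_add, Prod.smul_snd, smul_eq_mul]
      field_simp
      simp only [areaForm]; ring
  have hlow : cos (π / (4 * m + 2 : ℕ)) * gauge (regularPolygon (4 * m + 2)) x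
      * gauge (regularPolygon (4 * m + 2)) y ≤ |areaForm x y| := by
    have h1 := (hxy _).trans_eq (congrArg _ hdec)
    have h2 := h1.trans (gauge_smul_polygonVertex_le m _ k)
    rw [abs_div, abs_of_pos hw, le_div_iff₀ hw] at h2
    have h3 := mul_le_mul_of_nonneg_left hk hgx.le
    linarith
  have hup := abs_areaForm_le m hm x (y + t • x)
  have harea : areaForm x (y + t • x) = areaForm x y := by
    simp [areaForm]; ring
  rw [harea] at hup
  exact le_of_mul_le_mul_left (hlow.trans hup) (by positivity)
end

section
/- Let h > 0 and f : (0, h) → ℝ, f(h₂) = 2h/h₂ + h/(2·(h − h₂)). Then f is strictly decreasing on (0, 2h/3], strictly increasing on [2h/3, h), and its range is exactly [9/2, ∞); consequently for every p > 9/2 there exist exactly two values h₂ ∈ (0, h) with f(h₂) = p, and for p = 9/2 exactly one (h₂ = 2h/3). -/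
open Real

/-- The level sets of `2h/z + h/(2(h - z))` on `(0, h)` are cut out by a quadratic equation. -/
lemma halfPerimeter_eq_iff {h z : ℝ} (hz : z ∈ Set.Ioo 0 h) (p : ℝ) :
    2 * h / z + h / (2 * (h - z)) = p ↔
      2 * p * z ^ 2 - (2 * p + 3) * h * z + 4 * h ^ 2 = 0 := by
  have h0 : z ≠ 0 := hz.1.ne'
  have h1 : h - z ≠ 0 := (sub_pos.2 hz.2).ne'
  field_simp
  constructor <;> intro H <;> linear_combination H

lemma halfPerimeter_sub {h a b : ℝ} (ha : a ∈ Set.Ioo 0 h) (hb : b ∈ Set.Ioo 0 h) :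
    (2 * h / a + h / (2 * (h - a))) - (2 * h / b + h / (2 * (h - b))) =
      h * (b - a) * (4 * ((h - a) * (h - b)) - a * b) /
        (2 * (a * b) * ((h - a) * (h - b))) := by
  have ha0 : a ≠ 0 := ha.1.ne'
  have ha1 : h - a ≠ 0 := (sub_pos.2 ha.2).ne'
  have hb0 : b ≠ 0 := hb.1.ne'
  have hb1 : h - b ≠ 0 := (sub_pos.2 hb.2).ne'
  field_simp
  ring

lemma le_halfPerimeter {h z : ℝ} (hz : z ∈ Set.Ioo 0 h) :
    9 / 2 ≤ 2 * h / z + h / (2 * (h - z)) := by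
  have h0 : 0 < z := hz.1
  have h1 : 0 < h - z := sub_pos.2 hz.2
  have key : 2 * h / z + h / (2 * (h - z)) - 9 / 2 =
      (3 * z - 2 * h) ^ 2 / (2 * z * (h - z)) := by
    field_simp
    ring
  rw [← sub_nonneg, key]
  positivity

lemma halfPerimeter_eq_nine_halves_iff {h z : ℝ} (hz : z ∈ Set.Ioo 0 h) :
    2 * h / z + h / (2 * (h - z)) = 9 / 2 ↔ z = 2 * h / 3 := by
  rw [halfPerimeter_eq_iff hz]
  constructor
  · intro H
    have : 3 * z - 2 * h = 0 := pow_eq_zero_iff two_ne_zero |>.1 (by linear_combination H)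
    linarith
  · rintro rfl
    ring

lemma exists_two_halfPerimeter_eq {h p : ℝ} (hh : 0 < h) (hp : 9 / 2 < p) :
    ∃ x ∈ Set.Ioo 0 h, ∃ y ∈ Set.Ioo 0 h, x ≠ y ∧
      2 * h / x + h / (2 * (h - x)) = p ∧ 2 * h / y + h / (2 * (h - y)) = p ∧
      ∀ z ∈ Set.Ioo 0 h, 2 * h / z + h / (2 * (h - z)) = p → z = x ∨ z = y := by
  have hp0 : 0 < p := by linarith
  obtain ⟨r, hr0, hr⟩ : ∃ r : ℝ, 0 < r ∧ r ^ 2 = (2 * p - 1) * (2 * p - 9) := by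
    have hD : 0 < (2 * p - 1) * (2 * p - 9) := mul_pos (by linarith) (by linarith)
    exact ⟨√((2 * p - 1) * (2 * p - 9)), Real.sqrt_pos.2 hD, Real.sq_sqrt hD.le⟩
  have hr1 : r < 2 * p - 3 := by nlinarith
  have factor (z : ℝ) : 2 * p * z ^ 2 - (2 * p + 3) * h * z + 4 * h ^ 2 =
      2 * p * ((z - h * (2 * p + 3 - r) / (4 * p)) * (z - h * (2 * p + 3 + r) / (4 * p))) := by
    field_simp
    linear_combination 2 * h ^ 2 * hr
  have hx : h * (2 * p + 3 - r) / (4 * p) ∈ Set.Ioo 0 h := by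
    refine ⟨div_pos (mul_pos hh (by linarith)) (by linarith), ?_⟩
    rw [div_lt_iff₀ (by linarith)]
    exact mul_lt_mul_of_pos_left (by linarith) hh
  have hy : h * (2 * p + 3 + r) / (4 * p) ∈ Set.Ioo 0 h := by
    refine ⟨div_pos (mul_pos hh (by linarith)) (by linarith), ?_⟩
    rw [div_lt_iff₀ (by linarith)]
    exact mul_lt_mul_of_pos_left (by linarith) hh
  refine ⟨_, hx, _, hy, ?_, ?_, ?_, fun z hz H => ?_⟩
  · refine ne_of_lt (div_lt_div_of_pos_right ?_ (by linarith))
    exact mul_lt_mul_of_pos_left (by linarith) hh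
  · rw [halfPerimeter_eq_iff hx, factor]
    simp
  · rw [halfPerimeter_eq_iff hy, factor]
    simp
  · rw [halfPerimeter_eq_iff hz, factor] at H
    simpa [hp0.ne', sub_eq_zero] using H

/-- The half-perimeter function `f(h₂) = 2h/h₂ + h/(2(h − h₂))` of an offset isosceles
triangle is strictly decreasing on `(0, 2h/3]`, strictly increasing on `[2h/3, h)`, has
range exactly `[9/2, ∞)`; each value `p > 9/2` is attained at exactly two offsets and
`9/2` at exactly one (`h₂ = 2h/3`). -/
theorem stmt_15 (h : ℝ) (hh : 0 < h) (f : ℝ → ℝ)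
    (hf : ∀ h₂ : ℝ, f h₂ = 2 * h / h₂ + h / (2 * (h - h₂))) :
    StrictAntiOn f (Set.Ioc 0 (2 * h / 3)) ∧
    StrictMonoOn f (Set.Ico (2 * h / 3) h) ∧
    f '' Set.Ioo 0 h = Set.Ici (9 / 2) ∧
    (∀ p : ℝ, 9 / 2 < p → ∃ x ∈ Set.Ioo 0 h, ∃ y ∈ Set.Ioo 0 h, x ≠ y ∧
      f x = p ∧ f y = p ∧ ∀ z ∈ Set.Ioo 0 h, f z = p → z = x ∨ z = y) ∧
    (∀ z ∈ Set.Ioo 0 h, (f z = 9 / 2 ↔ z = 2 * h / 3)) := by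
  obtain rfl : f = fun x => 2 * h / x + h / (2 * (h - x)) := funext hf
  refine ⟨fun a ha b hb hab => ?_, fun a ha b hb hab => ?_, ?_,
    fun p hp => exists_two_halfPerimeter_eq hh hp,
    fun z hz => halfPerimeter_eq_nine_halves_iff hz⟩
  · have ha0 : 0 < a := ha.1
    have hb0 : 0 < b := hb.1
    have hb1 : b ≤ 2 * h / 3 := hb.2
    have ha' : 0 < h - a := by linarith
    have hb' : 0 < h - b := by linarith
    have hba : 0 < b - a := sub_pos.2 hab
    have hsign : 0 < 4 * ((h - a) * (h - b)) - a * b := by nlinarith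
    rw [← sub_pos, halfPerimeter_sub ⟨ha0, by linarith⟩ ⟨hb0, by linarith⟩]
    positivity
  · have ha1 : 2 * h / 3 ≤ a := ha.1
    have ha0 : 0 < a := by linarith
    have hb0 : 0 < b := ha0.trans hab
    have hb' : 0 < h - b := sub_pos.2 hb.2
    have ha' : 0 < h - a := by linarith
    have hsign : 4 * ((h - a) * (h - b)) - a * b < 0 := by nlinarith
    rw [← sub_neg, halfPerimeter_sub ⟨ha0, by linarith⟩ ⟨hb0, by linarith⟩]
    exact div_neg_of_neg_of_pos
      (mul_neg_of_pos_of_neg (mul_pos hh (sub_pos.2 hab)) hsign) (by positivity)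
  · ext p
    constructor
    · rintro ⟨z, hz, rfl⟩
      exact le_halfPerimeter hz
    · intro hp
      rcases (Set.mem_Ici.1 hp).eq_or_lt with rfl | hp
      · have hz : 2 * h / 3 ∈ Set.Ioo 0 h := ⟨by positivity, by linarith⟩
        exact ⟨_, hz, (halfPerimeter_eq_nine_halves_iff hz).2 rfl⟩
      · obtain ⟨x, hx, -, -, -, hxp, -⟩ := exists_two_halfPerimeter_eq hh hp
        exact ⟨x, hx, hxp⟩
end

section
/- Let a > 0. (A) For every H with 0 < H ≤ a, 2a/H + 2a/(3a − H) ≥ 3, with equality if and only if H = a; the function is strictly decreasing in H on (0, a]. (B) For every h with 0 < h ≤ a, 1 + a/(2a − h) + a/h ≥ 3, with equality if and only if h = a; this function is strictly decreasing on (0, a] and its range is exactly [3, ∞). (These are the half-perimeters of a regular hexagon of side a measured in the offset Minkowski norm with center displaced along each of the two non-equivalent axes of symmetry; in particular every value p ≥ 3 is attained as the half-perimeter of an offset hexagon.) -/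
open Real

theorem div_add_div_sub_eq {k c x : ℝ} (hx : x ≠ 0) (hcx : c - x ≠ 0) :
    k / x + k / (c - x) = k * c / (x * (c - x)) := by
  field_simp
  ring

theorem strictAntiOn_div_add_div_sub {k c : ℝ} (hk : 0 < k) :
    StrictAntiOn (fun x : ℝ => k / x + k / (c - x)) (Set.Ioc 0 (c / 2)) := by
  rintro x ⟨hx, hxc⟩ y ⟨hy, hyc⟩ hxy
  have hcx : 0 < c - x := by linarith
  have hcy : 0 < c - y := by linarith
  have hc : 0 < c := by linarith
  simp only [div_add_div_sub_eq hx.ne' hcx.ne', div_add_div_sub_eq hy.ne' hcy.ne']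
  apply div_lt_div_of_pos_left (by positivity) (by positivity)
  nlinarith [mul_pos (sub_pos.2 hxy) (show 0 < c - x - y by linarith)]

theorem StrictAntiOn.le_and_eq_iff_of_mem_Ioc {f : ℝ → ℝ} {a b m x : ℝ}
    (hf : StrictAntiOn f (Set.Ioc a b)) (hb : f b = m) (hx : x ∈ Set.Ioc a b) :
    m ≤ f x ∧ (f x = m ↔ x = b) := by
  have hmem : b ∈ Set.Ioc a b := ⟨hx.1.trans_le hx.2, le_rfl⟩
  subst hb
  exact ⟨hf.antitoneOn hx hmem hx.2, hf.injOn.eq_iff hx hmem⟩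

theorem exists_mem_Ioc_one_add_div_add_div_eq {a p : ℝ} (ha : 0 < a) (hp : 3 ≤ p) :
    ∃ h ∈ Set.Ioc 0 a, 1 + a / (2 * a - h) + a / h = p := by
  have hp1 : 0 < p - 1 := by linarith
  have hq : 2 / (p - 1) ≤ 1 := (div_le_one hp1).2 (by linarith)
  have hq0 : 0 < 2 / (p - 1) := by positivity
  have hs0 := Real.sqrt_nonneg (1 - 2 / (p - 1))
  have hs := Real.sq_sqrt (show 0 ≤ 1 - 2 / (p - 1) by linarith)
  set s := √(1 - 2 / (p - 1))
  have hs1 : s < 1 := by nlinarith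
  have hpos : 0 < a * (1 - s) := mul_pos ha (by linarith)
  have hle : a * (1 - s) ≤ a := by nlinarith
  refine ⟨a * (1 - s), ⟨hpos, hle⟩, ?_⟩
  have hprod : a * (1 - s) * (2 * a - a * (1 - s)) = a ^ 2 * (2 / (p - 1)) := by
    linear_combination -a ^ 2 * hs
  rw [add_assoc, add_comm (a / _),
    div_add_div_sub_eq hpos.ne' (by linarith), hprod]
  field_simp
  ring

/-- Half-perimeters of a regular hexagon of side `a` in the offset Minkowski norm, for the
two non-equivalent axes of symmetry: both are at least `3` with equality only at the
stated extreme offset, both are strictly decreasing, and the range of configuration B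
is exactly `[3, ∞)`. -/
theorem stmt_17 (a : ℝ) (ha : 0 < a) :
    (∀ H ∈ Set.Ioc 0 a, 3 ≤ 2 * a / H + 2 * a / (3 * a - H) ∧
      (2 * a / H + 2 * a / (3 * a - H) = 3 ↔ H = a)) ∧
    StrictAntiOn (fun H : ℝ => 2 * a / H + 2 * a / (3 * a - H)) (Set.Ioc 0 a) ∧
    (∀ h ∈ Set.Ioc 0 a, 3 ≤ 1 + a / (2 * a - h) + a / h ∧
      (1 + a / (2 * a - h) + a / h = 3 ↔ h = a)) ∧
    StrictAntiOn (fun h : ℝ => 1 + a / (2 * a - h) + a / h) (Set.Ioc 0 a) ∧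
    (fun h : ℝ => 1 + a / (2 * a - h) + a / h) '' Set.Ioc 0 a = Set.Ici 3 := by
  have hA : StrictAntiOn (fun H : ℝ => 2 * a / H + 2 * a / (3 * a - H)) (Set.Ioc 0 a) :=
    (strictAntiOn_div_add_div_sub (by positivity)).mono
      (Set.Ioc_subset_Ioc_right (by linarith))
  have hB : StrictAntiOn (fun h : ℝ => 1 + a / (2 * a - h) + a / h) (Set.Ioc 0 a) := by
    intro x hx y hy hxy
    have h := (strictAntiOn_div_add_div_sub (c := 2 * a) ha).mono
      (Set.Ioc_subset_Ioc_right (by linarith)) hx hy hxy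
    dsimp only at h ⊢
    linarith
  have hBmin : ∀ h ∈ Set.Ioc 0 a, 3 ≤ 1 + a / (2 * a - h) + a / h ∧
      (1 + a / (2 * a - h) + a / h = 3 ↔ h = a) := fun h hh =>
    hB.le_and_eq_iff_of_mem_Ioc
      (by rw [show 2 * a - a = a by ring, div_self ha.ne']; norm_num) hh
  refine ⟨fun H hH => hA.le_and_eq_iff_of_mem_Ioc ?_ hH, hA, hBmin, hB, ?_⟩
  · rw [show 3 * a - a = 2 * a by ring]
    field_simp
    norm_num
  · refine Set.Subset.antisymm ?_ fun p hp => exists_mem_Ioc_one_add_div_add_div_eq ha hp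
    rintro _ ⟨h, hh, rfl⟩
    exact (hBmin h hh).1
end
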